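/- arXiv:2501.10616 — 3 statements merged into one kernel-verified Lean document; each statement's English description precedes it below -/
import Mathlib

section
/- For all integers n ≥ 1, ℕ^φ(n) = φ(1+φ(2+φ(3+...+φ(n)...))) equals 1 if n = 1 or n = 2, equals 2 if n = 3 or n = 4, and equals 4 for all n ≥ 5. -/
/-- `scorePartial a n j` is the partial evaluation `A^φ(n, n - j)` of the
adversarial totient iteration for the sequence `a` (indexed from 1):
`scorePartial a n 0 = 0` corresponds to `A^φ(n,n) = 0`, and
`scorePartial a n (j+1) = φ(a (n-j) + scorePartial a n j)` corresponds to the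
recurrence `A^φ(n,k-1) = φ(a_k + A^φ(n,k))` with `k = n - j`.
Hence `A^φ(n,k) = scorePartial a n (n - k)`, and the scoreboard function is
`A^φ(n) = A^φ(n,0) = scorePartial a n n`. -/
def scorePartial (a : ℕ → ℕ) (n : ℕ) : ℕ → ℕ
  | 0 => 0
  | j + 1 => Nat.totient (a (n - j) + scorePartial a n j)

theorem Nat.totient_two_mul_le (m : ℕ) : Nat.totient (2 * m) ≤ m := by
  induction m using Nat.strong_induction_on with
  | _ m ih =>
    rcases Nat.even_or_odd m with h | h
    · rw [Nat.totient_two_mul_of_even h]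
      obtain ⟨r, rfl⟩ := h
      rcases Nat.eq_zero_or_pos r with rfl | hr
      · simp
      · have := ih r (by omega)
        rw [← two_mul]
        omega
    · rw [Nat.totient_two_mul_of_odd h]
      exact Nat.totient_le m

/-- Descending from index `8`, every even starting value up to `32` ends in `4`. -/
theorem totient_descent_from_eight (x : ℕ) (hx : Even x) (hle : x ≤ 32) :
    Nat.totient (1 + Nat.totient (2 + Nat.totient (3 + Nat.totient (4 +
      Nat.totient (5 + Nat.totient (6 + Nat.totient (7 + Nat.totient (8 + x)))))))) = 4 := by
  obtain ⟨r, rfl⟩ := hx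
  have hr : r ≤ 16 := by omega
  interval_cases r <;> decide +kernel

/-- The bound `x ≤ 3k + 8` on even values at even indices `k` propagates down to `k = 8`,
where it forces the final value `4`. -/
theorem scorePartial_id_eq_four_of_le (m : ℕ) : ∀ n j : ℕ, n = j + (2 * m + 8) →
    Even (scorePartial (fun i => i) n j) → scorePartial (fun i => i) n j ≤ 6 * m + 32 →
    scorePartial (fun i => i) n n = 4 := by
  induction m with
  | zero =>
    intro n j hn he hle
    have h := totient_descent_from_eight _ he (by omega)
    subst hn
    simp only [Nat.mul_zero, Nat.zero_add] at h ⊢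
    simp only [scorePartial]
    convert h using 16 <;> omega
  | succ m ih =>
    intro n j hn he hle
    have h1 : scorePartial (fun i => i) n (j + 1)
        = Nat.totient (n - j + scorePartial (fun i => i) n j) := rfl
    have h2 : scorePartial (fun i => i) n (j + 2)
        = Nat.totient (n - (j + 1) + scorePartial (fun i => i) n (j + 1)) := rfl
    refine ih n (j + 2) (by omega) ?_ ?_
    · rw [h2]
      exact Nat.totient_even (by omega)
    · obtain ⟨r, hr⟩ := he
      have hhalf := Nat.totient_two_mul_le (m + 5 + r)
      rw [show n - j + scorePartial (fun i => i) n j = 2 * (m + 5 + r) by omega] at h1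
      have hlt := Nat.totient_lt (n - (j + 1) + scorePartial (fun i => i) n (j + 1)) (by omega)
      omega

theorem stmt_3 (n : ℕ) (hn : 1 ≤ n) :
    scorePartial (fun j => j) n n =
      if n = 1 ∨ n = 2 then 1
      else if n = 3 ∨ n = 4 then 2
      else 4 := by
  rcases Nat.lt_or_ge n 8 with h | h
  · interval_cases n <;> decide +kernel
  · rw [if_neg (by omega), if_neg (by omega)]
    rcases Nat.even_or_odd' n with ⟨r, hr | hr⟩
    · exact scorePartial_id_eq_four_of_le (r - 4) n 0 (by omega) (by simp [scorePartial])
        (by simp [scorePartial])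
    · have h1 : scorePartial (fun i => i) n 1 = Nat.totient n := rfl
      refine scorePartial_id_eq_four_of_le (r - 4) n 1 (by omega) ?_ ?_
      · rw [h1]
        exact Nat.totient_even (by omega)
      · rw [h1]
        have := Nat.totient_le n
        omega
end

section
/- Let A = (1, 4, 9, ...) be the sequence of perfect squares, a_k = k². For all integers n ≥ 1 and all odd integers k with 1 ≤ k ≤ n, the partial evaluation satisfies A^φ(n,k) ≤ 2k² + 14k + 40. -/
theorem Nat.totient_le_half_of_even {m : ℕ} (hm : Even m) : 2 * Nat.totient m ≤ m := by
  induction m using Nat.strong_induction_on with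
  | _ m ih =>
    obtain ⟨r, rfl⟩ := hm
    obtain rfl | hr := Nat.eq_zero_or_pos r
    · simp
    rw [← two_mul]
    obtain h | h := Nat.even_or_odd r
    · rw [Nat.totient_mul_of_prime_of_dvd Nat.prime_two h.two_dvd]
      exact Nat.mul_le_mul_left 2 (ih r (by omega) h)
    · rw [Nat.totient_mul_of_prime_of_not_dvd Nat.prime_two h.not_two_dvd_nat]
      have := Nat.totient_le r
      omega

theorem scorePartial_sq_le (m : ℕ) : ∀ k : ℕ, Odd k →
    scorePartial (fun j => j ^ 2) (k + m) m ≤ 2 * k ^ 2 + 14 * k + 40 := by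
  induction m using Nat.twoStepInduction with
  | zero => simp [scorePartial]
  | one =>
    intro k _
    simp only [scorePartial]
    refine (Nat.totient_le _).trans ?_
    simp only [Nat.sub_zero]
    nlinarith
  | more m ih _ =>
    intro k hk
    have hb := ih (k + 2) (hk.add_even even_two)
    rw [show k + 2 + m = k + (m + 2) by ring] at hb
    simp only [scorePartial, show k + (m + 2) - m = k + 2 by omega,
      show k + (m + 2) - (m + 1) = k + 1 by omega]
    set v := scorePartial (fun j => j ^ 2) (k + (m + 2)) m
    have hv := Nat.totient_le ((k + 2) ^ 2 + v)
    have heven : Even (Nat.totient ((k + 2) ^ 2 + v)) := Nat.totient_even (by nlinarith)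
    have hsq : Even ((k + 1) ^ 2) := (hk.add_odd odd_one).pow_of_ne_zero two_ne_zero
    have hhalf := Nat.totient_le_half_of_even (hsq.add heven)
    ring_nf at hb hv hhalf ⊢
    omega

theorem stmt_8 (n k : ℕ) (hn : 1 ≤ n) (hk : Odd k) (hk1 : 1 ≤ k) (hkn : k ≤ n) :
    scorePartial (fun j => j ^ 2) n (n - k) ≤ 2 * k ^ 2 + 14 * k + 40 := by
  obtain ⟨m, rfl⟩ := Nat.exists_eq_add_of_le hkn
  rw [Nat.add_sub_cancel_left]
  exact scorePartial_sq_le m k hk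
end

section
/- Let A = (1, 4, 9, ...) be the sequence of perfect squares, a_k = k². For all integers n ≥ 1, the scoreboard value A^φ(n) = φ(1+φ(4+φ(9+...+φ(n²)...))) satisfies A^φ(n) ≤ 57. -/
theorem two_mul_totient_le_of_even {m : ℕ} (h : Even m) : 2 * Nat.totient m ≤ m := by
  obtain ⟨t, rfl⟩ := h
  rw [← two_mul]
  induction t using Nat.strong_induction_on with
  | _ t ih =>
    rcases Nat.even_or_odd t with ht | ht
    · rw [Nat.totient_two_mul_of_even ht]
      obtain ⟨s, rfl⟩ := ht
      rcases Nat.eq_zero_or_pos s with rfl | hs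
      · simp
      · have := ih s (by omega)
        rw [← two_mul]
        omega
    · rw [Nat.totient_two_mul_of_odd ht]
      have := Nat.totient_le t
      omega

/-- With `k = n - j`, the bounds at even and at odd `k` propagate downwards in `k` because
the argument of the totient is even whenever the square being added is. -/
theorem scorePartial_sq_bound (n j k : ℕ) (h : k + j = n) :
    (1 ≤ k → Even (scorePartial (fun i => i ^ 2) n j)) ∧
    (Even k → scorePartial (fun i => i ^ 2) n j ≤ 3 * k ^ 2 + 20 * k + 56) ∧
    (Odd k → 2 * scorePartial (fun i => i ^ 2) n j ≤
      4 * (k + 1) ^ 2 + 20 * (k + 1) + 56) := by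
  induction j generalizing k with
  | zero => simp [scorePartial]
  | succ j ih =>
    obtain ⟨h_even, h_bound_even, h_bound_odd⟩ := ih (k + 1) (by omega)
    have hk : n - j = k + 1 := by omega
    simp only [scorePartial, hk]
    generalize scorePartial (fun i => i ^ 2) n j = v at *
    refine ⟨fun h1 => Nat.totient_even (by nlinarith), fun he => ?_, fun ho => ?_⟩
    · have hv := h_bound_odd he.add_one
      by_cases h1 : 1 < (k + 1) ^ 2 + v
      · have := Nat.totient_lt _ h1
        nlinarith
      · have := Nat.totient_le ((k + 1) ^ 2 + v)
        nlinarith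
    · have hv := h_bound_even ho.add_one
      have hm : Even ((k + 1) ^ 2 + v) :=
        (ho.add_one.pow_of_ne_zero two_ne_zero).add (h_even (by omega))
      have := two_mul_totient_le_of_even hm
      nlinarith

theorem stmt_10 (n : ℕ) (hn : 1 ≤ n) :
    scorePartial (fun j => j ^ 2) n n ≤ 57 := by
  have := (scorePartial_sq_bound n n 0 (by omega)).2.1 (by simp)
  omega
end
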